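/- A symbolic matrix product including symmetric variables, of degree k ≥ 1 with ℓ variables, is positive semi-definite (for every n ≥ 1 and every admissible assignment, all complex eigenvalues of the evaluated product are real and nonnegative) if and only if P is symmetric, i.e. k is even and some cyclic shift of the word equals L·Lᵀ for a word L of length k/2. -/

import Mathlib

open Matrix

/-- The three possible exponents of a factor: the variable itself (`one`),
its transpose (`tr`), or a symmetric variable (`sym`). -/
inductive SymExp : Type
  | one : SymExp
  | tr : SymExp
  | sym : SymExp
  deriving DecidableEq

/-- The formal transpose of an exponent: flips `one ↔ tr` and fixes `sym`. -/
def SymExp.formalT : SymExp → SymExp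
  | .one => .tr
  | .tr => .one
  | .sym => .sym

/-- Evaluation of the symbolic matrix product including symmetric variables:
the `i`-th factor is `A (ι i)` if `τ i ∈ {one, sym}` and `(A (ι i))ᵀ` if `τ i = tr`. -/
noncomputable def evalWordS {k ℓ n : ℕ} (ι : Fin k → Fin ℓ) (τ : Fin k → SymExp)
    (A : Fin ℓ → Matrix (Fin n) (Fin n) ℝ) : Matrix (Fin n) (Fin n) ℝ :=
  ((List.finRange k).map (fun i => if τ i = SymExp.tr then (A (ι i))ᵀ else A (ι i))).prod

/-- `P` is positive semi-definite: for every `n ≥ 1` and every admissible assignment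
(the matrix assigned to a variable carrying exponent `sym` is symmetric), every complex
eigenvalue (root of the characteristic polynomial, mapped into `ℂ`) is real and
nonnegative. -/
def PositiveSemidefiniteS {k ℓ : ℕ} (ι : Fin k → Fin ℓ) (τ : Fin k → SymExp) : Prop :=
  ∀ n : ℕ, 1 ≤ n → ∀ A : Fin ℓ → Matrix (Fin n) (Fin n) ℝ,
    (∀ i : Fin k, τ i = SymExp.sym → (A (ι i))ᵀ = A (ι i)) →
    ∀ μ : ℂ,
      (Polynomial.map (algebraMap ℝ ℂ) (Matrix.charpoly (evalWordS ι τ A))).IsRoot μ →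
      μ.im = 0 ∧ 0 ≤ μ.re

/-- `P` is symmetric: `k` is even and some cyclic shift of the word can be written as
`L·Lᵀ`, where `L` is a word of length `k/2` and `Lᵀ` its formal-transpose reversal. -/
def SymmetricWordS {k ℓ : ℕ} (hk : 0 < k) (ι : Fin k → Fin ℓ) (τ : Fin k → SymExp) : Prop :=
  k % 2 = 0 ∧ ∃ j : ℕ, j < k ∧ ∀ s : ℕ, s < k / 2 →
    ι ⟨(j + 1 + s) % k, Nat.mod_lt _ hk⟩ = ι ⟨(j + k - s) % k, Nat.mod_lt _ hk⟩ ∧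
    τ ⟨(j + 1 + s) % k, Nat.mod_lt _ hk⟩ =
      (τ ⟨(j + k - s) % k, Nat.mod_lt _ hk⟩).formalT

open Polynomial in
theorem Matrix.isRoot_charpoly_iff_exists_mulVec {α K : Type*} [Fintype α] [DecidableEq α] [Field K]
    (M : Matrix α α K) (μ : K) :
    M.charpoly.IsRoot μ ↔ ∃ v ≠ 0, M *ᵥ v = μ • v := by
  rw [Polynomial.IsRoot, Matrix.eval_charpoly, ← Matrix.exists_mulVec_eq_zero_iff]
  refine exists_congr fun v => and_congr_right fun _ => ?_
  rw [Matrix.sub_mulVec, sub_eq_zero, eq_comm, Matrix.scalar_apply, ← Matrix.smul_one_eq_diagonal,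
    Matrix.smul_mulVec, Matrix.one_mulVec]

/-- The real matrix of size `2n` underlying a complex matrix of size `n`. -/
noncomputable def realification {α : Type*} [Fintype α] [DecidableEq α] :
    Matrix α α ℂ →* Matrix (α ⊕ α) (α ⊕ α) ℝ where
  toFun C := Matrix.fromBlocks (C.map Complex.re) (-C.map Complex.im)
    (C.map Complex.im) (C.map Complex.re)
  map_one' := by
    ext (i | i) (j | j) <;> by_cases h : i = j <;> simp [Matrix.one_apply, h]
  map_mul' C D := by
    ext (i | i) (j | j) <;>
      simp [Matrix.mul_apply, Finset.sum_add_distrib, sub_eq_add_neg, add_comm]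

theorem realification_conjTranspose {α : Type*} [Fintype α] [DecidableEq α] (C : Matrix α α ℂ) :
    realification Cᴴ = (realification C)ᵀ := by
  ext (i | i) (j | j) <;> simp [realification]

theorem isRoot_charpoly_realification {α : Type*} [Fintype α] [DecidableEq α] {C : Matrix α α ℂ}
    {μ : ℂ} (h : C.charpoly.IsRoot μ) :
    ((realification C).charpoly.map (algebraMap ℝ ℂ)).IsRoot μ := by
  rw [← Matrix.charpoly_map, Matrix.isRoot_charpoly_iff_exists_mulVec]
  obtain ⟨v, hv, hCv⟩ := (Matrix.isRoot_charpoly_iff_exists_mulVec _ _).1 h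
  refine ⟨Sum.elim v (-Complex.I • v), fun h0 => hv ?_, ?_⟩
  · ext i
    simpa using congrFun h0 (Sum.inl i)
  · have key : ∀ i, ∑ j, ((C i j).re : ℂ) * v j + ∑ j, ((C i j).im : ℂ) * (Complex.I * v j)
        = μ * v i := fun i => by
      have := congrFun hCv i
      simp only [Matrix.mulVec, dotProduct, Pi.smul_apply, smul_eq_mul] at this
      rw [← this, ← Finset.sum_add_distrib]
      refine Finset.sum_congr rfl fun j _ => ?_
      conv_rhs => rw [← Complex.re_add_im (C i j)]
      ring
    ext (i | i)
    · simpa [realification, Matrix.mulVec, dotProduct] using key i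
    · have := congrArg (fun x => -Complex.I * x) (key i)
      simp only [mul_add, Finset.mul_sum] at this
      simp only [realification, Matrix.mulVec, dotProduct, Fintype.sum_sum_type]
      simp only [MonoidHom.coe_mk, OneHom.coe_mk, Matrix.map_apply, Matrix.fromBlocks_apply₂₁,
        Matrix.fromBlocks_apply₂₂, Sum.elim_inl, Sum.elim_inr, Pi.smul_apply, smul_eq_mul,
        Complex.coe_algebraMap]
      rw [add_comm]
      convert this using 1
      · congr 1 <;> refine Finset.sum_congr rfl fun j _ => ?_
        · ring
        · linear_combination ((C i j).im : ℂ) * v j * Complex.I_mul_I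
      · ring

theorem Matrix.trace_im_eq_zero_of_roots {α : Type*} [Fintype α] [DecidableEq α] {M : Matrix α α ℂ}
    (h : ∀ μ, M.charpoly.IsRoot μ → μ.im = 0) : M.trace.im = 0 := by
  rw [Matrix.trace_eq_sum_roots_charpoly, ← Complex.coe_imAddGroupHom, map_multiset_sum]
  refine Multiset.sum_eq_zero fun x hx => ?_
  obtain ⟨μ, hμ, rfl⟩ := Multiset.mem_map.1 hx
  exact h μ (Polynomial.isRoot_of_mem_roots hμ)

/-- Positive semi-definiteness passes to complex matrices, with symmetric variables replaced by
Hermitian ones. -/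
theorem PositiveSemidefiniteS.complex {k ℓ : ℕ} {ι : Fin k → Fin ℓ} {τ : Fin k → SymExp}
    (h : PositiveSemidefiniteS ι τ) {α : Type*} [Fintype α] [DecidableEq α] [Nonempty α]
    (B : Fin ℓ → Matrix α α ℂ) (hB : ∀ i, τ i = SymExp.sym → (B (ι i))ᴴ = B (ι i))
    {μ : ℂ} (hμ : (((List.finRange k).map
      (fun i => if τ i = SymExp.tr then (B (ι i))ᴴ else B (ι i))).prod).charpoly.IsRoot μ) :
    μ.im = 0 ∧ 0 ≤ μ.re := by
  let e := Fintype.equivFin (α ⊕ α)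
  let φ := Matrix.reindexAlgEquiv ℝ ℝ e
  refine h (Fintype.card (α ⊕ α)) Fintype.card_pos (fun m => φ (realification (B m)))
    (fun i hi => ?_) μ ?_
  · conv_rhs => rw [← hB i hi, realification_conjTranspose]
    rfl
  · have := isRoot_charpoly_realification hμ
    rw [← Matrix.charpoly_reindex e] at this
    convert this
    rw [evalWordS, map_list_prod (realification (α := α)), ← Matrix.coe_reindexAlgEquiv ℝ ℝ,
      map_list_prod (Matrix.reindexAlgEquiv ℝ ℝ e), List.map_map, List.map_map]
    congr 1
    refine List.map_congr_left fun i _ => ?_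
    by_cases hi : τ i = SymExp.tr
    · simp only [hi, if_true, Function.comp, realification_conjTranspose]
      rfl
    · simp [hi, φ]

/-- The displacements, with multiplicity, of the walks of length `j` starting at `u` on the cyclic
word with labels `a`, `t` that read the first `j` letters of that word. -/
def walkEnds {k ℓ : ℕ} (a : ZMod k → Fin ℓ) (t : ZMod k → SymExp) (u : ZMod k) : ℕ → List ℤ
  | 0 => [0]
  | j + 1 => (walkEnds a t u j).flatMap fun d : ℤ =>
      (if a (u + d) = a j ∧ t (u + d) = t j then [d + 1] else []) ++
      (if a (u + d - 1) = a j ∧ t (u + d - 1) = (t j).formalT then [d - 1] else [])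

theorem mem_walkEnds_succ {k ℓ : ℕ} {a : ZMod k → Fin ℓ} {t : ZMod k → SymExp} {u : ZMod k} {j : ℕ}
    {x : ℤ} : x ∈ walkEnds a t u (j + 1) ↔ ∃ d ∈ walkEnds a t u j,
      (a (u + d) = a j ∧ t (u + d) = t j ∧ x = d + 1) ∨
      (a (u + d - 1) = a j ∧ t (u + d - 1) = (t j).formalT ∧ x = d - 1) := by
  simp only [walkEnds, List.mem_flatMap, List.mem_append, List.mem_ite_nil_right,
    List.mem_singleton, and_assoc]

theorem bounds_of_mem_walkEnds {k ℓ : ℕ} {a : ZMod k → Fin ℓ} {t : ZMod k → SymExp} {u : ZMod k}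
    {j : ℕ} {x : ℤ} (hx : x ∈ walkEnds a t u j) : -j ≤ x ∧ x ≤ j ∧ (x - j) % 2 = 0 := by
  induction j generalizing x with
  | zero => simp_all [walkEnds]
  | succ j ih =>
    obtain ⟨d, hd, h⟩ := mem_walkEnds_succ.1 hx
    have := ih hd
    push_cast
    omega

theorem labels_of_neg_mem_walkEnds {k ℓ : ℕ} {a : ZMod k → Fin ℓ} {t : ZMod k → SymExp}
    {u : ZMod k} {j : ℕ} (hx : -(j : ℤ) ∈ walkEnds a t u j) (i : ℕ) (hi : i < j) :
    a (u - i - 1) = a i ∧ t (u - i - 1) = (t i).formalT := by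
  induction j generalizing i with
  | zero => omega
  | succ j ih =>
    obtain ⟨d, hd, h⟩ := mem_walkEnds_succ.1 hx
    have hb := bounds_of_mem_walkEnds hd
    obtain rfl : d = -j := by push_cast at h; omega
    rcases Nat.lt_succ_iff_lt_or_eq.1 hi with hi | rfl
    · exact ih hd i hi
    · rcases h with h | h
      · push_cast at h; omega
      · simpa [sub_eq_add_neg] using And.intro h.1 h.2.1

theorem self_mem_walkEnds_zero {k ℓ : ℕ} (a : ZMod k → Fin ℓ) (t : ZMod k → SymExp) (j : ℕ) :
    (j : ℤ) ∈ walkEnds a t 0 j := by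
  induction j with
  | zero => simp [walkEnds]
  | succ j ih => exact mem_walkEnds_succ.2 ⟨j, ih, Or.inl (by simp)⟩

/-- The adjacency matrix of the letter `m` on the cyclic word with labels `a`, `t`, where a step
along an edge has weight `z` in the positive direction and `star z` in the negative one. -/
noncomputable def cyclicLetter {k ℓ : ℕ} (z : ℂ) (a : ZMod k → Fin ℓ) (t : ZMod k → SymExp)
    (m : Fin ℓ) : Matrix (ZMod k) (ZMod k) ℂ := Matrix.of fun u v =>
  (if u + 1 = v ∧ a u = m ∧ t u ≠ SymExp.tr then z else 0) +
  (if u = v + 1 ∧ a v = m ∧ t v ≠ SymExp.one then star z else 0)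

/-- The matrix substituted for the factor of the cyclic word at position `i`. -/
noncomputable def cyclicFactor {k ℓ : ℕ} (z : ℂ) (a : ZMod k → Fin ℓ) (t : ZMod k → SymExp)
    (i : ZMod k) : Matrix (ZMod k) (ZMod k) ℂ :=
  if t i = SymExp.tr then (cyclicLetter z a t (a i))ᴴ else cyclicLetter z a t (a i)

theorem cyclicFactor_apply {k ℓ : ℕ} (z : ℂ) {a : ZMod k → Fin ℓ} {t : ZMod k → SymExp}
    (hcons : ∀ i i', t i = SymExp.sym → a i' = a i → t i' = SymExp.sym) (i u v : ZMod k) :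
    cyclicFactor z a t i u v =
      (if u + 1 = v then if a u = a i ∧ t u = t i then z else 0 else 0) +
      (if u - 1 = v then if a (u - 1) = a i ∧ t (u - 1) = (t i).formalT then star z else 0
        else 0) := by
  have hs : ∀ x, a x = a i → (t x = SymExp.sym ↔ t i = SymExp.sym) := fun x hx =>
    ⟨fun h => hcons x i h hx.symm, fun h => hcons i x h hx⟩
  have h1 : (u + 1 = v ∧ a u = a i ∧ (if t i = SymExp.tr then t u ≠ SymExp.one else
      t u ≠ SymExp.tr)) ↔ (u + 1 = v ∧ a u = a i ∧ t u = t i) := by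
    refine and_congr_right fun _ => and_congr_right fun hx => ?_
    have := hs u hx
    cases h : t i <;> cases h' : t u <;> simp_all
  have h2 : (u = v + 1 ∧ a v = a i ∧ (if t i = SymExp.tr then t v ≠ SymExp.tr else
      t v ≠ SymExp.one)) ↔
      (u - 1 = v ∧ a (u - 1) = a i ∧ t (u - 1) = (t i).formalT) := by
    rw [← sub_eq_iff_eq_add]
    refine and_congr_right fun hv => ?_
    rw [hv]
    refine and_congr_right fun hx => ?_
    have := hs v hx
    cases h : t i <;> cases h' : t v <;> simp_all [SymExp.formalT]
  simp only [← ite_and, ← h1, ← h2]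
  by_cases h : t i = SymExp.tr
  · simp only [cyclicFactor, cyclicLetter, h, if_true, Matrix.conjTranspose_apply, Matrix.of_apply,
      star_add, apply_ite star, star_star, star_zero]
    rw [add_comm]
    simp only [eq_comm]
  · simp only [cyclicFactor, cyclicLetter, h, if_false, Matrix.of_apply]

theorem prod_cyclicFactor_apply {k ℓ : ℕ} [NeZero k] {z : ℂ} (hz : star z = z⁻¹) (hz0 : z ≠ 0)
    {a : ZMod k → Fin ℓ} {t : ZMod k → SymExp}
    (hcons : ∀ i i', t i = SymExp.sym → a i' = a i → t i' = SymExp.sym) (j : ℕ) (u v : ZMod k) :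
    ((List.range j).map fun i : ℕ => cyclicFactor z a t i).prod u v =
      ((walkEnds a t u j).map fun d : ℤ => if u + d = v then z ^ d else 0).sum := by
  induction j generalizing v with
  | zero => simp [walkEnds, Matrix.one_apply]
  | succ j ih =>
    rw [List.range_succ, List.map_append, List.prod_append, Matrix.mul_apply]
    simp only [ih, List.map_singleton, List.prod_singleton, walkEnds]
    induction walkEnds a t u j with
    | nil => simp
    | cons d S ihS =>
      simp only [List.map_cons, List.sum_cons, add_mul, Finset.sum_add_distrib, ihS,
        List.flatMap_cons, List.map_append, List.sum_append]
      congr 1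
      simp only [ite_mul, zero_mul, Finset.sum_ite_eq, Finset.mem_univ, if_true,
        cyclicFactor_apply z hcons, hz]
      split_ifs <;> simp_all [zpow_add₀, zpow_sub₀, mul_add, ← add_assoc, div_eq_mul_inv,
        add_sub_assoc]

theorem exists_star_eq_inv_pow_eq_I {k : ℕ} (hk : 0 < k) :
    ∃ z : ℂ, z ≠ 0 ∧ star z = z⁻¹ ∧ z ^ k = Complex.I := by
  obtain ⟨z, hz⟩ := IsAlgClosed.exists_pow_nat_eq Complex.I hk
  have hn : ‖z‖ = 1 := by
    rw [← pow_eq_one_iff_of_nonneg (norm_nonneg z) hk.ne', ← norm_pow, hz, Complex.norm_I]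
  refine ⟨z, by rintro rfl; simp at hn, ?_, hz⟩
  rw [Complex.inv_def, Complex.normSq_eq_norm_sq, hn]
  simp

/-- If a matrix preserves a coordinate splitting and has real spectrum, then the partial traces
are real. -/
theorem sum_diag_im_eq_zero {α : Type*} [Fintype α] [DecidableEq α] {Q : Matrix α α ℂ}
    (hQ : ∀ μ, Q.charpoly.IsRoot μ → μ.im = 0) (p : α → Prop) [DecidablePred p]
    (hp : ∀ u v, Q u v ≠ 0 → (p u ↔ p v)) :
    (∑ u, if p u then Q u u else 0).im = 0 := by
  let E : Matrix α α ℂ := Matrix.diagonal fun u => if p u then 1 else 0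
  have hE : E * E = E := by
    simp only [E, Matrix.diagonal_mul_diagonal]
    congr 1; ext u; split_ifs <;> simp
  have hcomm : E * Q = Q * E := by
    ext u v
    by_cases h : Q u v = 0
    · simp [E, h]
    · simp [E, hp u v h]
  have htr : (∑ u, if p u then Q u u else 0) = (Q * E).trace := by
    simp [Matrix.trace, E]
  rw [htr]
  refine Matrix.trace_im_eq_zero_of_roots fun μ hμ => ?_
  by_cases h0 : μ = 0
  · simp [h0]
  obtain ⟨v, hv, hQv⟩ := (Matrix.isRoot_charpoly_iff_exists_mulVec _ _).1 hμ
  refine hQ μ ((Matrix.isRoot_charpoly_iff_exists_mulVec _ _).2 ⟨v, hv, ?_⟩)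
  have hEv : E *ᵥ v = v := by
    have : μ • (E *ᵥ v) = μ • v := by
      rw [← Matrix.mulVec_smul, ← hQv, Matrix.mulVec_mulVec, ← Matrix.mul_assoc, hcomm,
        Matrix.mul_assoc, hE]
    exact smul_right_injective _ h0 this
  rw [← hQv, ← Matrix.mulVec_mulVec, hEv]

theorem PositiveSemidefiniteS.even {k ℓ : ℕ} {ι : Fin k → Fin ℓ} {τ : Fin k → SymExp}
    (h : PositiveSemidefiniteS ι τ) : k % 2 = 0 := by
  by_contra hk
  have hodd : Odd k := Nat.odd_iff.2 (by omega)
  have := h.complex (α := Unit) (fun _ => -1) (by simp) (μ := -1) (by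
    rw [Matrix.isRoot_charpoly_iff_exists_mulVec]
    refine ⟨1, one_ne_zero, ?_⟩
    simp [hodd.neg_one_pow, Matrix.neg_mulVec])
  norm_num at this

theorem List.map_finRange_eq_map_range {β : Type*} (k : ℕ) (g : ℕ → β) :
    (List.finRange k).map (fun i : Fin k => g i) = (List.range k).map g := by
  rw [← List.map_coe_finRange_eq_range, List.map_map]
  rfl

theorem PositiveSemidefiniteS.exists_reflection {k ℓ : ℕ} [NeZero k] {ι : Fin k → Fin ℓ}
    {τ : Fin k → SymExp} (hpsd : PositiveSemidefiniteS ι τ)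
    {a : ZMod k → Fin ℓ} {t : ZMod k → SymExp}
    (ha : ∀ i : Fin k, ι i = a (i : ℕ)) (ht : ∀ i : Fin k, τ i = t (i : ℕ))
    (hcons : ∀ i i', t i = SymExp.sym → a i' = a i → t i' = SymExp.sym) :
    ∃ c : ℕ, ∀ i : ZMod k,
      a (2 * c - i - 1) = a i ∧ t (2 * c - i - 1) = (t i).formalT := by
  have hk : 0 < k := NeZero.pos k
  have h2 : 2 ∣ k := Nat.dvd_of_mod_eq_zero hpsd.even
  obtain ⟨z, hz0, hz, hzk⟩ := exists_star_eq_inv_pow_eq_I hk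
  let par := ZMod.castHom h2 (ZMod 2)
  by_contra hno
  have hneg : ∀ u : ZMod k, par u = 0 → -(k : ℤ) ∉ walkEnds a t u k := fun u hu hmem => by
    obtain ⟨c, hc⟩ : 2 ∣ u.val := by
      rw [← ZMod.natCast_eq_zero_iff, ← hu]
      conv_rhs => rw [← ZMod.natCast_zmod_val u]
      exact (map_natCast par _).symm
    refine hno ⟨c, fun i => ?_⟩
    have := labels_of_neg_mem_walkEnds hmem i.val i.val_lt
    rw [← ZMod.natCast_zmod_val u, hc, ZMod.natCast_zmod_val] at this
    exact_mod_cast this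
  let Q := ((List.range k).map fun i : ℕ => cyclicFactor z a t i).prod
  have hQ : ∀ u v, Q u v = ((walkEnds a t u k).map fun d : ℤ => if u + d = v then z ^ d else 0).sum :=
    prod_cyclicFactor_apply hz hz0 hcons k
  have hroot : ∀ μ, Q.charpoly.IsRoot μ → μ.im = 0 := fun μ hμ => by
    refine (hpsd.complex (cyclicLetter z a t) (fun i hi => ?_) (μ := μ) ?_).1
    · rw [ht] at hi
      rw [ha]
      have hs : ∀ x, a x = a (i : ℕ) → t x = SymExp.sym := fun x hx => hcons _ x hi hx
      ext u v
      simp only [cyclicLetter, Matrix.conjTranspose_apply, Matrix.of_apply, star_add,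
        apply_ite star, star_star, star_zero]
      rw [add_comm]
      congr 1 <;> refine if_congr ?_ rfl rfl
      · constructor
        · rintro ⟨h1, h3, -⟩; exact ⟨h1.symm, h3, by simp [hs _ h3]⟩
        · rintro ⟨h1, h3, -⟩; exact ⟨h1.symm, h3, by simp [hs _ h3]⟩
      · constructor
        · rintro ⟨h1, h3, -⟩; exact ⟨h1.symm, h3, by simp [hs _ h3]⟩
        · rintro ⟨h1, h3, -⟩; exact ⟨h1.symm, h3, by simp [hs _ h3]⟩
    · simp only [ha, ht]
      rw [List.map_finRange_eq_map_range k fun i : ℕ => if t i = SymExp.tr then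
        (cyclicLetter z a t (a i))ᴴ else cyclicLetter z a t (a i)]
      exact hμ
  have hpar : ∀ u v, Q u v ≠ 0 → (par u = 0 ↔ par v = 0) := fun u v huv => by
    rw [hQ] at huv
    obtain ⟨x, hx, hx0⟩ := List.exists_mem_ne_zero_of_sum_ne_zero huv
    obtain ⟨d, hd, rfl⟩ := List.mem_map.1 hx
    have hv : u + d = v := by by_contra h; simp [h] at hx0
    have hd2 : ((d : ℤ) : ZMod 2) = 0 := by
      rw [ZMod.intCast_zmod_eq_zero_iff_dvd]
      have := (bounds_of_mem_walkEnds hd).2.2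
      omega
    rw [← hv, map_add, map_intCast, hd2, add_zero]
  have hterm : ∀ u, par u = 0 → ∀ d ∈ walkEnds a t u k,
      0 ≤ (if u + (d : ZMod k) = u then z ^ d else 0).im := fun u hu d hd => by
    split_ifs with h
    · have hdvd : (k : ℤ) ∣ d := by
        rw [← ZMod.intCast_zmod_eq_zero_iff_dvd]
        simpa using h
      obtain ⟨hl, hr, -⟩ := bounds_of_mem_walkEnds hd
      have hne : d ≠ -k := fun h' => hneg u hu (h' ▸ hd)
      obtain ⟨q, rfl⟩ := hdvd
      have hk' : (0 : ℤ) < k := by exact_mod_cast hk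
      have hq1 : q ≤ 1 := by nlinarith
      have hq2 : -1 ≤ q := by nlinarith
      have hq3 : q ≠ -1 := by rintro rfl; simp at hne
      obtain rfl | rfl : q = 0 ∨ q = 1 := by omega
      · simp
      · simp [hzk]
    · simp
  have him : ∀ u, (Q u u).im =
      ((walkEnds a t u k).map fun d : ℤ => (if u + d = u then z ^ d else 0).im).sum := fun u => by
    rw [hQ, ← Complex.coe_imAddGroupHom, map_list_sum, List.map_map]
    rfl
  have hnonneg : ∀ u, par u = 0 → 0 ≤ (Q u u).im := fun u hu => by
    rw [him]
    refine List.sum_nonneg fun x hx => ?_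
    obtain ⟨d, hd, rfl⟩ := List.mem_map.1 hx
    exact hterm u hu d hd
  have hpos : 0 < (Q 0 0).im := by
    rw [him]
    refine lt_of_lt_of_le (b := (1 : ℝ)) one_pos (List.single_le_sum (fun x hx => ?_) _ ?_)
    · obtain ⟨d, hd, rfl⟩ := List.mem_map.1 hx
      exact hterm 0 (map_zero _) d hd
    · exact List.mem_map.2 ⟨k, self_mem_walkEnds_zero a t k, by simp [hzk]⟩
  have := sum_diag_im_eq_zero hroot (fun u => par u = 0) hpar
  rw [Complex.im_sum] at this
  refine absurd this (ne_of_gt (Finset.sum_pos' (fun u _ => ?_) ⟨0, Finset.mem_univ _, ?_⟩))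
  · split_ifs with hu
    · exact hnonneg u hu
    · simp
  · simpa using hpos

theorem PositiveSemidefiniteS.symmetricWordS {k ℓ : ℕ} (hk : 0 < k)
    {ι : Fin k → Fin ℓ} {τ : Fin k → SymExp}
    (hcons : ∀ i i' : Fin k, τ i = SymExp.sym → ι i' = ι i → τ i' = SymExp.sym)
    (h : PositiveSemidefiniteS ι τ) : SymmetricWordS hk ι τ := by
  have : NeZero k := ⟨hk.ne'⟩
  let r : ZMod k → Fin k := fun x => ⟨x.val, x.val_lt⟩
  have hr : ∀ n : ℕ, r n = ⟨n % k, Nat.mod_lt _ hk⟩ := fun n => Fin.ext (ZMod.val_natCast k n)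
  have hr' : ∀ i : Fin k, i = r (i : ℕ) := fun i => by
    rw [hr]; exact Fin.ext (Nat.mod_eq_of_lt i.2).symm
  obtain ⟨c, hc⟩ := h.exists_reflection (a := ι ∘ r) (t := τ ∘ r)
    (fun i => congrArg ι (hr' i)) (fun i => congrArg τ (hr' i)) (fun i i' => hcons (r i) (r i'))
  refine ⟨h.even, (c + k - 1) % k, Nat.mod_lt _ hk, fun s hs => ?_⟩
  have key := hc (((c + k - 1) % k + k - s : ℕ) : ZMod k)
  have hidx : (2 * c - (((c + k - 1) % k + k - s : ℕ) : ZMod k) - 1) =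
      (((c + k - 1) % k + 1 + s : ℕ) : ZMod k) := by
    have h1 : s ≤ (c + k - 1) % k + k := by omega
    have h2 : 1 ≤ c + k := by omega
    push_cast [Nat.cast_sub h1, Nat.cast_sub h2, ZMod.natCast_mod, CharP.cast_eq_zero]
    ring
  rw [hidx] at key
  simpa only [Function.comp, hr] using key

theorem Matrix.charpoly_prod_map_range_add {n k : ℕ} (G : ℕ → Matrix (Fin n) (Fin n) ℝ)
    (hG : ∀ i, G (i + k) = G i) (m : ℕ) :
    ((List.range k).map fun i => G (m + i)).prod.charpoly =
      ((List.range k).map G).prod.charpoly := by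
  induction m with
  | zero => simp
  | succ m ih =>
    rw [← ih]
    cases k with
    | zero => rfl
    | succ k =>
      have h1 : G (m + 1 + k) = G (m + 0) := by rw [add_zero, ← hG m]; congr 1; ring
      rw [List.prod_range_succ, Matrix.charpoly_mul_comm, h1,
        List.prod_range_succ' fun i => G (m + i)]
      simp only [Nat.succ_eq_add_one, add_assoc, add_comm 1]

theorem SymmetricWordS.positiveSemidefiniteS {k ℓ : ℕ} {hk : 0 < k}
    {ι : Fin k → Fin ℓ} {τ : Fin k → SymExp} (h : SymmetricWordS hk ι τ) :
    PositiveSemidefiniteS ι τ := by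
  obtain ⟨hk2, j, hj, hsym⟩ := h
  intro n _ A hA μ hμ
  let F : Fin k → Matrix (Fin n) (Fin n) ℝ :=
    fun i => if τ i = SymExp.tr then (A (ι i))ᵀ else A (ι i)
  let G : ℕ → Matrix (Fin n) (Fin n) ℝ := fun i => F ⟨i % k, Nat.mod_lt _ hk⟩
  have hG : ∀ i, G (i + k) = G i := fun i => by simp [G]
  have heval : evalWordS ι τ A = ((List.range k).map G).prod := by
    rw [evalWordS, ← List.map_finRange_eq_map_range k G]
    congr 1
    refine List.map_congr_left fun i _ => ?_
    have : (⟨(i : ℕ) % k, Nat.mod_lt _ hk⟩ : Fin k) = i := Fin.ext (Nat.mod_eq_of_lt i.2)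
    simp [G, F, this]
  have hrefl : ∀ s < k / 2, G (j + 1 + s) = (G (j + k - s))ᵀ := fun s hs => by
    obtain ⟨h1, h2⟩ := hsym s hs
    have hA' := hA ⟨(j + k - s) % k, Nat.mod_lt _ hk⟩
    simp only [G, F, h1, h2]
    cases h3 : τ ⟨(j + k - s) % k, Nat.mod_lt _ hk⟩ <;> simp_all [SymExp.formalT]
  obtain ⟨q, rfl⟩ : ∃ q, k = q + q := ⟨k / 2, by omega⟩
  have hq : (q + q) / 2 = q := by omega
  rw [hq] at hrefl
  let L := ((List.range q).map fun i => G (j + 1 + q + i)).prod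
  have hprod : ∀ m ≤ q, ((List.range m).map fun s => G (j + 1 + s)).prod =
      (((List.range m).map fun i => G (j + 1 + (q + q) - m + i)).prod)ᵀ := by
    intro m
    induction m with
    | zero => simp
    | succ m ih =>
      intro hm
      have h1 : ∀ i, j + 1 + (q + q) - (m + 1) + (i + 1) = j + 1 + (q + q) - m + i := by omega
      have h2 : j + 1 + (q + q) - (m + 1) + 0 = j + (q + q) - m := by omega
      rw [List.prod_range_succ, List.prod_range_succ', Matrix.transpose_mul, ih (by omega),
        hrefl m (by omega)]
      simp only [Nat.succ_eq_add_one, h1, h2]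
  have hLL : ((List.range (q + q)).map fun i => G (j + 1 + q + i)).prod = L * Lᵀ := by
    rw [List.range_add, List.map_append, List.prod_append, List.map_map]
    congr 1
    have := hprod q le_rfl
    simp only [show j + 1 + (q + q) - q = j + 1 + q by omega] at this
    rw [← this]
    congr 1
    refine List.map_congr_left fun i _ => ?_
    rw [← hG (j + 1 + i)]
    simp only [Function.comp]
    congr 1; omega
  have hpsd : (L * Lᵀ).PosSemidef := by
    simpa using Matrix.posSemidef_self_mul_conjTranspose L
  rw [heval, ← Matrix.charpoly_prod_map_range_add G hG (j + 1 + q), hLL,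
    hpsd.isHermitian.charpoly_eq, Polynomial.map_prod, Polynomial.isRoot_prod] at hμ
  obtain ⟨i, -, hi⟩ := hμ
  have hμi : μ = (hpsd.isHermitian.eigenvalues i : ℂ) := by
    simpa [Polynomial.IsRoot, sub_eq_zero] using hi
  rw [hμi]
  exact ⟨Complex.ofReal_im _, by simpa using hpsd.eigenvalues_nonneg i⟩

/-- A symbolic matrix product including symmetric variables is positive semi-definite
if and only if it is symmetric. -/
theorem positiveSemidefiniteS_iff_symmetric {k ℓ : ℕ} (hk : 0 < k)
    (ι : Fin k → Fin ℓ) (τ : Fin k → SymExp)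
    (hcons : ∀ i i' : Fin k, τ i = SymExp.sym → ι i' = ι i → τ i' = SymExp.sym) :
    PositiveSemidefiniteS ι τ ↔ SymmetricWordS hk ι τ :=
  ⟨fun h => h.symmetricWordS hk hcons, fun h => h.positiveSemidefiniteS⟩
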